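/- arXiv:1511.08734 — 2 statements merged into one kernel-verified Lean document; each statement's English description precedes it below -/
import Mathlib

section
/- Let H = {1, 10, 24, 44, 98, 100, 201} ⊆ Z_239, a subgroup of order 7 of Z_239^*, and set X1 = ⋃_{j ∈ J} H·j, X2 = ⋃_{k ∈ K} H·k, X3 = ⋃_{l ∈ L} H·l, where J = {1,2,3,4,5,6,7,8,14,16,18,19,34,39,57,58,95}, K = {5,9,14,15,17,18,21,23,29,34,35,39,45,47,57,58}, L = {0,1,6,7,8,13,15,16,17,23,28,35,57,63,85,107}. Then (X1, X2, X3) is a supplementary difference set in Z_239 with parameters (239; 119, 112, 106; 158). -/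
/-- Supplementary difference set predicate (see paper's Definition 1). -/
def IsSDS (v t : ℕ) (X : Fin t → Finset (ZMod v)) (k : Fin t → ℕ) (lam : ℤ) : Prop :=
  (∀ i, (X i).card = k i) ∧
  ∀ c : ZMod v, c ≠ 0 →
    ((∑ i, (((X i) ×ˢ (X i)).filter (fun p => p.1 - p.2 = c)).card : ℕ) : ℤ) = lam

/-- Number of set bits of `m` among the first `n`. -/
def bitCount (m : ℕ) (n : ℕ) : ℕ :=
  Nat.rec 0 (fun i r => r + (m >>> i) % 2) n

theorem bitCount_eq (m n : ℕ) :
    bitCount m n = ((Finset.range n).filter (fun i => m.testBit i = true)).card := by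
  induction n with
  | zero => rfl
  | succ n ih =>
    have h : bitCount m (n + 1) = bitCount m n + (m >>> n) % 2 := rfl
    rw [h, ih, Finset.range_add_one, Finset.filter_insert]
    have h2 : m.testBit n = decide ((m >>> n) % 2 = 1) := by
      rw [Nat.testBit_eq_decide_div_mod_eq, Nat.shiftRight_eq_div_pow]
    by_cases hb : (m >>> n) % 2 = 1
    · simp [h2, hb]
    · have : (m >>> n) % 2 = 0 := by omega
      simp [h2, this]

/-- The subset of `ZMod 239` with characteristic bit mask `M`. -/
def maskSet (M : ℕ) : Finset (ZMod 239) :=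
  Finset.univ.filter (fun x => M.testBit x.val = true)

theorem mem_maskSet (M : ℕ) (x : ZMod 239) : x ∈ maskSet M ↔ M.testBit x.val = true := by
  simp [maskSet]

theorem card_filter_val (p : ℕ → Prop) [DecidablePred p] :
    ((Finset.univ : Finset (ZMod 239)).filter (fun x => p x.val)).card
      = ((Finset.range 239).filter p).card := by
  refine Finset.card_bij (fun x _ => x.val) ?_ ?_ ?_
  · intro x hx
    simp only [Finset.mem_filter, Finset.mem_univ, true_and, Finset.mem_range] at hx ⊢
    exact ⟨ZMod.val_lt x, hx⟩
  · intro x _ y _ h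
    exact ZMod.val_injective 239 h
  · intro n hn
    simp only [Finset.mem_filter, Finset.mem_range] at hn
    have hv : ((n : ZMod 239)).val = n := ZMod.val_cast_of_lt hn.1
    exact ⟨(n : ZMod 239), by simp only [Finset.mem_filter, Finset.mem_univ, true_and, hv, hn.2], hv⟩

/-- Number of differences equal to `c`, by bit operations. -/
def corr (M c : ℕ) : ℕ := bitCount (((M + M <<< 239) >>> c) &&& M) 239

theorem card_maskSet (M : ℕ) : (maskSet M).card = bitCount M 239 := by
  rw [bitCount_eq, maskSet, card_filter_val (fun i => M.testBit i = true)]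

theorem testBit_double (M : ℕ) (hM : M < 2 ^ 239) (i c : ℕ) (hi : i < 239) (hc : c < 239) :
    (M + M <<< 239).testBit (c + i) = M.testBit ((i + c) % 239) := by
  have h : M + M <<< 239 = 2 ^ 239 * M + M := by
    rw [Nat.shiftLeft_eq, Nat.mul_comm M, Nat.add_comm M]
  rw [h, Nat.testBit_two_pow_mul_add _ hM]
  split
  · rw [Nat.mod_eq_of_lt (by omega), Nat.add_comm]
  · have e : c + i - 239 = (i + c) % 239 := by omega
    rw [e]

theorem card_diff (M : ℕ) (hM : M < 2 ^ 239) (c : ZMod 239) :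
    (((maskSet M) ×ˢ (maskSet M)).filter (fun p => p.1 - p.2 = c)).card = corr M c.val := by
  rw [corr, bitCount_eq, ← card_filter_val]
  symm
  refine Finset.card_bij (fun b _ => (b + c, b)) ?_ ?_ ?_
  · intro b hb
    simp only [Finset.mem_filter, Finset.mem_univ, true_and, Nat.testBit_and,
      Nat.testBit_shiftRight, Bool.and_eq_true] at hb
    rw [testBit_double M hM _ _ (ZMod.val_lt b) (ZMod.val_lt c)] at hb
    simp only [Finset.mem_filter, Finset.mem_product, mem_maskSet, ZMod.val_add]
    exact ⟨hb, by ring⟩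
  · intro x _ y _ h
    exact (Prod.mk.inj h).2
  · rintro ⟨a, b⟩ h
    simp only [Finset.mem_filter, Finset.mem_product, mem_maskSet] at h
    obtain ⟨⟨ha, hb⟩, hd⟩ := h
    have hab : a = b + c := by rw [← hd]; ring
    refine ⟨b, ?_, by rw [hab]⟩
    simp only [Finset.mem_filter, Finset.mem_univ, true_and, Nat.testBit_and,
      Nat.testBit_shiftRight, Bool.and_eq_true]
    rw [testBit_double M hM _ _ (ZMod.val_lt b) (ZMod.val_lt c), ← ZMod.val_add, ← hab]
    exact ⟨ha, hb⟩

def mask1 : ℕ := 263111631021864856114535193212336966086678564989836580942547531337653758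
def mask2 : ℕ := 233017891478203892302591030622008183643234708798426448663730211206386208
def mask3 : ℕ := 174424122808559773843662676291970026010795338313634979814074806647893443

theorem corr_total : ∀ c < 239, c ≠ 0 → corr mask1 c + corr mask2 c + corr mask3 c = 158 := by
  decide +kernel

/-- The unions of orbits of the order-7 subgroup `H = {1,10,24,44,98,100,201}` of
`(ZMod 239)ˣ` over the listed representative sets form an SDS with parameters
`(239; 119, 112, 106; 158)`. -/
theorem sds_239_third :
    let H : Finset (ZMod 239) := {1, 10, 24, 44, 98, 100, 201}
    let J : Finset (ZMod 239) := {1, 2, 3, 4, 5, 6, 7, 8, 14, 16, 18, 19, 34, 39, 57, 58, 95}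
    let K : Finset (ZMod 239) := {5, 9, 14, 15, 17, 18, 21, 23, 29, 34, 35, 39, 45, 47, 57, 58}
    let L : Finset (ZMod 239) := {0, 1, 6, 7, 8, 13, 15, 16, 17, 23, 28, 35, 57, 63, 85, 107}
    IsSDS 239 3
      ![J.biUnion (fun j => H.image (fun h => h * j)),
        K.biUnion (fun k => H.image (fun h => h * k)),
        L.biUnion (fun l => H.image (fun h => h * l))]
      ![119, 112, 106] 158 := by
  intro H J K L
  have e1 : J.biUnion (fun j => H.image (fun h => h * j)) = maskSet mask1 := by decide +kernel
  have e2 : K.biUnion (fun k => H.image (fun h => h * k)) = maskSet mask2 := by decide +kernel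
  have e3 : L.biUnion (fun l => H.image (fun h => h * l)) = maskSet mask3 := by decide +kernel
  rw [e1, e2, e3]
  have b1 : mask1 < 2 ^ 239 := by decide +kernel
  have b2 : mask2 < 2 ^ 239 := by decide +kernel
  have b3 : mask3 < 2 ^ 239 := by decide +kernel
  have c1 : bitCount mask1 239 = 119 := by decide +kernel
  have c2 : bitCount mask2 239 = 112 := by decide +kernel
  have c3 : bitCount mask3 239 = 106 := by decide +kernel
  refine ⟨?_, ?_⟩
  · intro i
    fin_cases i
    · exact (card_maskSet mask1).trans c1
    · exact (card_maskSet mask2).trans c2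
    · exact (card_maskSet mask3).trans c3
  · intro c hc
    have h := corr_total c.val (ZMod.val_lt c) (fun h0 => hc ((ZMod.val_eq_zero c).mp h0))
    rw [Fin.sum_univ_three]
    have d1 := card_diff mask1 b1 c
    have d2 := card_diff mask2 b2 c
    have d3 := card_diff mask3 b3 c
    rw [← d1, ← d2, ← d3] at h
    exact congrArg (Nat.cast : ℕ → ℤ) h
end

section
/- Let H = {1, 74, 80, 85, 111, 120, 167, 180, 270, 274, 293} ⊆ Z_331, a subgroup of order 11 of Z_331^*, and set X0 = ⋃_{m ∈ M} H·m, X1 = ⋃_{j ∈ J} H·j, X2 = ⋃_{k ∈ K} H·k, X3 = ⋃_{l ∈ L} H·l, where M = {2,4,8,10,14,16,20,28,38,31,32,37,56,62,64}, J = {0,1,2,5,10,13,19,22,28,31,37,53,56,64,101}, K = {0,1,5,7,8,10,11,16,31,38,41,56,62,64,73}, L = {0,1,7,8,10,13,14,19,22,32,37,44,62,73,76}. Then (X0, X1, X2, X3) is a supplementary difference set in Z_331 with parameters (331; 165, 155, 155, 155; 299), and X0 is of skew type. -/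
/-- `X ⊆ ZMod v` is of skew type: `0 ∉ X` and for each nonzero `i`, `i ∈ X ↔ -i ∉ X`. -/
def IsSkewType (v : ℕ) (X : Finset (ZMod v)) : Prop :=
  (0 : ZMod v) ∉ X ∧ ∀ i : ZMod v, i ≠ 0 → (i ∈ X ↔ -i ∉ X)

/-- Number of positions `x < n` whose bit is set in `N` and whose shift by `c` modulo 331 is too. -/
def cnt (N c : ℕ) : ℕ → ℕ
  | 0 => 0
  | n + 1 => (N >>> n) % 2 * ((N >>> ((n + c) % 331)) % 2) + cnt N c n

/-- Subset of `ZMod 331` coded by the bits of `N`. -/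
def T (N : ℕ) : Finset (ZMod 331) := Finset.univ.filter (fun x => (N >>> x.val) % 2 = 1)

def HH : Finset (ZMod 331) := {1, 74, 80, 85, 111, 120, 167, 180, 270, 274, 293}
def NM : ℕ := 2360809645426596497219939816741312078655699686989238269737739843343787701550189428762126471201806172
def NJ : ℕ := 53160497372118294232871071653743131643535971135340118261574002120746030254024538988483152439714863
def NK : ℕ := 2708971364392831395480516173140001371784336640459045599113903549857578994448858342626294079829810595
def NL : ℕ := 1795423671480507947550743821688950988158415456611398148634848530763673798723243798350390818484581763

theorem cnt_eq (N c n : ℕ) : cnt N c n =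
    ∑ x ∈ Finset.range n, (N >>> x) % 2 * ((N >>> ((x + c) % 331)) % 2) := by
  induction n with
  | zero => rfl
  | succ n ih => rw [Finset.sum_range_succ, ← ih, cnt, add_comm]

theorem card_T (N : ℕ) (c : ZMod 331) :
    (((T N) ×ˢ (T N)).filter (fun p => p.1 - p.2 = c)).card = cnt N c.val 331 := by
  have h1 : (((T N) ×ˢ (T N)).filter (fun p => p.1 - p.2 = c)).card =
      ((Finset.univ : Finset (ZMod 331)).filter (fun y => y ∈ T N ∧ y + c ∈ T N)).card := by
    refine Finset.card_bij' (fun p _ => p.2) (fun y _ => (y + c, y)) ?_ ?_ ?_ ?_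
    · rintro ⟨a, b⟩ h
      simp only [Finset.mem_filter, Finset.mem_product] at h
      obtain ⟨⟨ha, hb⟩, rfl⟩ := h
      simp [ha, hb]
    · intro y h
      simp only [Finset.mem_filter, Finset.mem_univ, true_and] at h
      simp [h.1, h.2]
    · rintro ⟨a, b⟩ h
      simp only [Finset.mem_filter, Finset.mem_product] at h
      obtain ⟨⟨ha, hb⟩, rfl⟩ := h
      simp
    · intro y h
      rfl
  rw [h1, cnt_eq, Finset.card_filter, Finset.sum_range]
  refine Finset.sum_congr (ι := ZMod 331) rfl ?_
  intro (y : ZMod 331) _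
  have hv : (y + c).val = (y.val + c.val) % 331 := ZMod.val_add y c
  simp only [T, Finset.mem_filter, Finset.mem_univ, true_and]
  rw [hv]
  change _ = (N >>> y.val) % 2 * ((N >>> ((y.val + c.val) % 331)) % 2)
  rcases Nat.mod_two_eq_zero_or_one (N >>> y.val) with h | h <;>
  rcases Nat.mod_two_eq_zero_or_one (N >>> ((y.val + c.val) % 331)) with h' | h' <;>
  simp [h, h']

theorem card_T0 (N : ℕ) : (T N).card = cnt N 0 331 := by
  rw [← ZMod.val_zero (n := 331), ← card_T]
  symm
  refine Finset.card_bij' (fun p _ => p.2) (fun y _ => (y, y)) ?_ ?_ ?_ ?_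
  · rintro ⟨a, b⟩ h
    simp only [Finset.mem_filter, Finset.mem_product] at h
    exact h.1.2
  · intro y h
    simp [h]
  · rintro ⟨a, b⟩ h
    simp only [Finset.mem_filter, Finset.mem_product, sub_eq_zero] at h
    simp [h.2]
  · intro y h
    rfl

theorem eq_T (R : Finset (ZMod 331)) (N : ℕ)
    (h1 : ∀ m ∈ R, ∀ h ∈ HH, (N >>> (h * m).val) % 2 = 1)
    (h2 : ∀ x : ZMod 331, (N >>> x.val) % 2 = 1 → ∃ m ∈ R, ∃ h ∈ HH, h * m = x) :
    R.biUnion (fun m => HH.image (fun h => h * m)) = T N := by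
  ext x
  simp only [Finset.mem_biUnion, Finset.mem_image, T, Finset.mem_filter, Finset.mem_univ, true_and]
  constructor
  · rintro ⟨m, hm, h, hh, rfl⟩
    exact h1 m hm h hh
  · exact h2 x

/-- Representatives of the orbits of `HH` on the nonzero residues. -/
def RR : Finset ℕ := {1, 2, 4, 5, 7, 8, 10, 11, 13, 14, 16, 19, 20, 22, 28, 31, 32, 37, 38, 41, 44, 49, 53, 56, 62, 64, 73, 76, 88, 101}

theorem cnt_reps : ∀ c ∈ RR,
    cnt NM c 331 + cnt NJ c 331 + cnt NK c 331 + cnt NL c 331 = 299 := by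
  decide +kernel

theorem reps_cover : ∀ c : ZMod 331, c ≠ 0 → ∃ h ∈ HH, (h * c).val ∈ RR := by
  decide +kernel

theorem HH_mul : ∀ a ∈ HH, ∀ b ∈ HH, a * b ∈ HH := by
  decide +kernel

theorem HH_inv : ∀ a ∈ HH, ∃ b ∈ HH, b * a = 1 := by
  decide +kernel

/-- Difference counts of a union of `HH`-orbits are constant on `HH`-orbits. -/
theorem cnt_mul (R : Finset (ZMod 331)) (N : ℕ)
    (hR : R.biUnion (fun m => HH.image (fun h => h * m)) = T N)
    (u : ZMod 331) (hu : u ∈ HH) (c : ZMod 331) :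
    cnt N (u * c).val 331 = cnt N c.val 331 := by
  have closed : ∀ w ∈ HH, ∀ x ∈ T N, w * x ∈ T N := by
    intro w hw x hx
    rw [← hR] at hx ⊢
    simp only [Finset.mem_biUnion, Finset.mem_image] at hx ⊢
    obtain ⟨m, hm, h, hh, rfl⟩ := hx
    exact ⟨m, hm, w * h, HH_mul w hw h hh, mul_assoc w h m⟩
  obtain ⟨w, hw, hwu⟩ := HH_inv u hu
  have huw : u * w = 1 := by rw [mul_comm, hwu]
  rw [← card_T, ← card_T]
  refine Finset.card_bij' (fun p _ => (w * p.1, w * p.2)) (fun p _ => (u * p.1, u * p.2))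
    ?_ ?_ ?_ ?_
  · rintro ⟨a, b⟩ h
    simp only [Finset.mem_filter, Finset.mem_product] at h ⊢
    refine ⟨⟨closed w hw a h.1.1, closed w hw b h.1.2⟩, ?_⟩
    rw [← mul_sub, h.2, ← mul_assoc, hwu, one_mul]
  · rintro ⟨a, b⟩ h
    simp only [Finset.mem_filter, Finset.mem_product] at h ⊢
    refine ⟨⟨closed u hu a h.1.1, closed u hu b h.1.2⟩, ?_⟩
    rw [← mul_sub, h.2]
  · rintro ⟨a, b⟩ _
    simp only [← mul_assoc, huw, one_mul]
  · rintro ⟨a, b⟩ _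
    simp only [← mul_assoc, hwu, one_mul]

theorem skew_T : IsSkewType 331 (T NM) := by
  unfold IsSkewType
  simp only [T, Finset.mem_filter, Finset.mem_univ, true_and]
  decide +kernel

theorem eq_M : ({2, 4, 8, 10, 14, 16, 20, 28, 38, 31, 32, 37, 56, 62, 64} : Finset (ZMod 331)).biUnion
    (fun m => HH.image (fun h => h * m)) = T NM := by
  apply eq_T
  · decide +kernel
  · decide +kernel

theorem eq_J : ({0, 1, 2, 5, 10, 13, 19, 22, 28, 31, 37, 53, 56, 64, 101} : Finset (ZMod 331)).biUnion
    (fun m => HH.image (fun h => h * m)) = T NJ := by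
  apply eq_T
  · decide +kernel
  · decide +kernel

theorem eq_K : ({0, 1, 5, 7, 8, 10, 11, 16, 31, 38, 41, 56, 62, 64, 73} : Finset (ZMod 331)).biUnion
    (fun m => HH.image (fun h => h * m)) = T NK := by
  apply eq_T
  · decide +kernel
  · decide +kernel

theorem eq_L : ({0, 1, 7, 8, 10, 13, 14, 19, 22, 32, 37, 44, 62, 73, 76} : Finset (ZMod 331)).biUnion
    (fun m => HH.image (fun h => h * m)) = T NL := by
  apply eq_T
  · decide +kernel
  · decide +kernel

/-- The unions of orbits of the order-11 subgroup
`H = {1,74,80,85,111,120,167,180,270,274,293}` of `(ZMod 331)ˣ` over the listed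
representative sets form an SDS with parameters `(331; 165, 155, 155, 155; 299)`
whose first block is of skew type. -/
theorem sds_331_first :
    let H : Finset (ZMod 331) := {1, 74, 80, 85, 111, 120, 167, 180, 270, 274, 293}
    let M : Finset (ZMod 331) := {2, 4, 8, 10, 14, 16, 20, 28, 38, 31, 32, 37, 56, 62, 64}
    let J : Finset (ZMod 331) := {0, 1, 2, 5, 10, 13, 19, 22, 28, 31, 37, 53, 56, 64, 101}
    let K : Finset (ZMod 331) := {0, 1, 5, 7, 8, 10, 11, 16, 31, 38, 41, 56, 62, 64, 73}
    let L : Finset (ZMod 331) := {0, 1, 7, 8, 10, 13, 14, 19, 22, 32, 37, 44, 62, 73, 76}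
    IsSDS 331 4
      ![M.biUnion (fun m => H.image (fun h => h * m)),
        J.biUnion (fun j => H.image (fun h => h * j)),
        K.biUnion (fun k => H.image (fun h => h * k)),
        L.biUnion (fun l => H.image (fun h => h * l))]
      ![165, 155, 155, 155] 299 ∧
    IsSkewType 331 (M.biUnion (fun m => H.image (fun h => h * m))) := by
  intro H M J K L
  have eM : M.biUnion (fun m => H.image (fun h => h * m)) = T NM := eq_M
  have eJ : J.biUnion (fun m => H.image (fun h => h * m)) = T NJ := eq_J
  have eK : K.biUnion (fun m => H.image (fun h => h * m)) = T NK := eq_K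
  have eL : L.biUnion (fun m => H.image (fun h => h * m)) = T NL := eq_L
  rw [eM, eJ, eK, eL]
  refine ⟨⟨?_, ?_⟩, skew_T⟩
  · intro i
    fin_cases i
    · exact (card_T0 NM).trans (by decide +kernel)
    · exact (card_T0 NJ).trans (by decide +kernel)
    · exact (card_T0 NK).trans (by decide +kernel)
    · exact (card_T0 NL).trans (by decide +kernel)
  · intro c hc
    obtain ⟨u, hu, hr⟩ := reps_cover c hc
    have key := cnt_reps _ hr
    rw [cnt_mul _ _ eq_M u hu, cnt_mul _ _ eq_J u hu, cnt_mul _ _ eq_K u hu,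
      cnt_mul _ _ eq_L u hu] at key
    rw [← card_T, ← card_T, ← card_T, ← card_T] at key
    rw [Fin.sum_univ_four]
    exact_mod_cast key
end
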